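/- The polynomial f(x) = (x² − 7)(x² − 11)(x² − 19)(x² − 31)(x² − 45353) has a root modulo every positive integer but has no rational root. -/

import Mathlib

/-- A square root of `a` modulo an odd prime `p` not dividing `a` lifts modulo every power. -/
theorem exists_prime_pow_dvd_sq_sub {p : ℕ} (hp : p.Prime) (hp2 : p ≠ 2) {a x₀ : ℤ}
    (ha : ¬ (p : ℤ) ∣ a) (hx₀ : (p : ℤ) ∣ x₀ ^ 2 - a) (n : ℕ) :
    ∃ x : ℤ, (p : ℤ) ^ n ∣ x ^ 2 - a := by
  have hpi : Prime (p : ℤ) := Nat.prime_iff_prime_int.mp hp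
  suffices ∀ n : ℕ, ∃ x : ℤ, (p : ℤ) ^ (n + 1) ∣ x ^ 2 - a by
    obtain ⟨x, hx⟩ := this n
    exact ⟨x, (pow_dvd_pow _ n.le_succ).trans hx⟩
  intro n
  induction n with
  | zero => exact ⟨x₀, by simpa using hx₀⟩
  | succ n ih =>
    obtain ⟨x, c, hc⟩ := ih
    have hpx : ¬ (p : ℤ) ∣ 2 * x := by
      intro h
      rcases hpi.dvd_or_dvd h with h | h
      · have h2 : p ∣ 2 := by exact_mod_cast h
        exact hp2 ((Nat.prime_dvd_prime_iff_eq hp Nat.prime_two).mp h2)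
      · apply ha
        have h1 : (p : ℤ) ∣ x ^ 2 - a := hc ▸ Dvd.dvd.mul_right (dvd_pow_self _ n.succ_ne_zero) c
        have h2 : (p : ℤ) ∣ x ^ 2 := dvd_pow h two_ne_zero
        simpa using dvd_sub h2 h1
    obtain ⟨v, u, huv⟩ := (hpi.irreducible.coprime_iff_not_dvd).mpr hpx
    refine ⟨x - (p : ℤ) ^ (n + 1) * (c * u), c * v + (p : ℤ) ^ n * (c * u) ^ 2, ?_⟩
    linear_combination hc - (p : ℤ) ^ (n + 1) * c * huv

/-- An integer congruent to `1` modulo `8` is a square modulo every power of `2`. -/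
theorem exists_two_pow_dvd_sq_sub {a : ℤ} (ha : 8 ∣ 1 - a) (n : ℕ) :
    ∃ x : ℤ, (2 : ℤ) ^ n ∣ x ^ 2 - a := by
  suffices ∀ n : ℕ, ∃ x : ℤ, Odd x ∧ (2 : ℤ) ^ (n + 3) ∣ x ^ 2 - a by
    obtain ⟨x, -, hx⟩ := this n
    exact ⟨x, (pow_dvd_pow _ (by omega)).trans hx⟩
  intro n
  induction n with
  | zero => exact ⟨1, odd_one, by simpa using ha⟩
  | succ n ih =>
    obtain ⟨x, ⟨y, rfl⟩, c, hc⟩ := ih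
    rcases Int.even_or_odd' c with ⟨d, rfl | rfl⟩
    · exact ⟨2 * y + 1, ⟨y, rfl⟩, d, by linear_combination hc⟩
    · refine ⟨2 * y + 1 + 2 ^ (n + 2), ⟨y + 2 ^ (n + 1), by ring⟩, d + y + 1 + 2 ^ n, ?_⟩
      linear_combination hc

/-- A polynomial with roots modulo two coprime integers has a root modulo their product. -/
theorem exists_mul_dvd_eval (f : Polynomial ℤ) {a b : ℤ} (hab : IsCoprime a b)
    (ha : ∃ x, a ∣ f.eval x) (hb : ∃ x, b ∣ f.eval x) : ∃ x, a * b ∣ f.eval x := by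
  obtain ⟨x, hx⟩ := ha
  obtain ⟨y, hy⟩ := hb
  obtain ⟨u, v, huv⟩ := hab
  refine ⟨x * (v * b) + y * (u * a), IsCoprime.mul_dvd ⟨u, v, huv⟩ ?_ ?_⟩
  · refine (dvd_iff_dvd_of_dvd_sub (dvd_trans ?_ (f.sub_dvd_eval_sub _ x))).mpr hx
    exact ⟨u * (y - x), by linear_combination x * huv⟩
  · refine (dvd_iff_dvd_of_dvd_sub (dvd_trans ?_ (f.sub_dvd_eval_sub _ y))).mpr hy
    exact ⟨v * (x - y), by linear_combination y * huv⟩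

/-- In a finite field of prime order, at least one of four nonzero elements and their product
is a square. -/
theorem isSquare_of_four_or_isSquare_mul {p : ℕ} [Fact p.Prime] {a b c d : ZMod p}
    (ha : a ≠ 0) (hb : b ≠ 0) (hc : c ≠ 0) (hd : d ≠ 0) :
    IsSquare a ∨ IsSquare b ∨ IsSquare c ∨ IsSquare d ∨ IsSquare (a * b * c * d) := by
  by_contra! h
  obtain ⟨h1, h2, h3, h4, h5⟩ := h
  apply h5
  rw [← quadraticChar_one_iff_isSquare (by simp [*])]
  rw [← quadraticChar_neg_one_iff_not_isSquare] at h1 h2 h3 h4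
  rw [map_mul, map_mul, map_mul, h1, h2, h3, h4]
  norm_num

theorem exists_dvd_sq_sub_of_isSquare {p : ℕ} {a : ℤ} (h : IsSquare (a : ZMod p)) :
    ∃ x : ℤ, (p : ℤ) ∣ x ^ 2 - a := by
  obtain ⟨y, hy⟩ := h
  obtain ⟨x, rfl⟩ := ZMod.intCast_surjective y
  refine ⟨x, (ZMod.intCast_zmod_eq_zero_iff_dvd _ p).mp ?_⟩
  push_cast
  rw [hy]
  ring

theorem exists_prime_pow_dvd_sq_sub_product {p : ℕ} (hp : p.Prime) (n : ℕ) :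
    ∃ x : ℤ, (p : ℤ) ^ n ∣
      (x ^ 2 - 7) * (x ^ 2 - 11) * (x ^ 2 - 19) * (x ^ 2 - 31) * (x ^ 2 - 45353) := by
  suffices ∃ a : ℤ, (a = 7 ∨ a = 11 ∨ a = 19 ∨ a = 31 ∨ a = 45353) ∧
      ∃ x : ℤ, (p : ℤ) ^ n ∣ x ^ 2 - a by
    obtain ⟨a, ha, x, hx⟩ := this
    refine ⟨x, hx.trans ?_⟩
    rcases ha with rfl | rfl | rfl | rfl | rfl
    · exact ⟨(x ^ 2 - 11) * (x ^ 2 - 19) * (x ^ 2 - 31) * (x ^ 2 - 45353), by ring⟩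
    · exact ⟨(x ^ 2 - 7) * (x ^ 2 - 19) * (x ^ 2 - 31) * (x ^ 2 - 45353), by ring⟩
    · exact ⟨(x ^ 2 - 7) * (x ^ 2 - 11) * (x ^ 2 - 31) * (x ^ 2 - 45353), by ring⟩
    · exact ⟨(x ^ 2 - 7) * (x ^ 2 - 11) * (x ^ 2 - 19) * (x ^ 2 - 45353), by ring⟩
    · exact dvd_mul_left _ _
  by_cases h2 : p = 2
  · subst h2
    exact ⟨45353, by simp, exists_two_pow_dvd_sq_sub (by norm_num) n⟩
  by_cases h7 : p = 7
  · subst h7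
    exact ⟨11, by simp, exists_prime_pow_dvd_sq_sub (x₀ := 2) hp h2 (by norm_num) (by norm_num) n⟩
  by_cases h11 : p = 11
  · subst h11
    exact ⟨31, by simp, exists_prime_pow_dvd_sq_sub (x₀ := 3) hp h2 (by norm_num) (by norm_num) n⟩
  by_cases h19 : p = 19
  · subst h19
    exact ⟨7, by simp, exists_prime_pow_dvd_sq_sub (x₀ := 8) hp h2 (by norm_num) (by norm_num) n⟩
  by_cases h31 : p = 31
  · subst h31
    exact ⟨7, by simp, exists_prime_pow_dvd_sq_sub (x₀ := 10) hp h2 (by norm_num) (by norm_num) n⟩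
  have hpi : Prime (p : ℤ) := Nat.prime_iff_prime_int.mp hp
  have not_dvd {q : ℕ} (hq : q.Prime) (hpq : p ≠ q) : ¬ (p : ℤ) ∣ (q : ℤ) := by
    rw [Int.natCast_dvd_natCast, Nat.prime_dvd_prime_iff_eq hp hq]
    exact hpq
  have d7 : ¬ (p : ℤ) ∣ 7 := not_dvd (q := 7) (by norm_num) h7
  have d11 : ¬ (p : ℤ) ∣ 11 := not_dvd (q := 11) (by norm_num) h11
  have d19 : ¬ (p : ℤ) ∣ 19 := not_dvd (q := 19) (by norm_num) h19
  have d31 : ¬ (p : ℤ) ∣ 31 := not_dvd (q := 31) (by norm_num) h31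
  have d : ¬ (p : ℤ) ∣ 45353 := by
    rw [show (45353 : ℤ) = 7 * 11 * 19 * 31 by norm_num]
    simp only [hpi.dvd_mul]
    tauto
  have : Fact p.Prime := ⟨hp⟩
  have lift {a : ℤ} (ha : ¬ (p : ℤ) ∣ a) (h : IsSquare (a : ZMod p)) :
      ∃ x : ℤ, (p : ℤ) ^ n ∣ x ^ 2 - a := by
    obtain ⟨x, hx⟩ := exists_dvd_sq_sub_of_isSquare h
    exact exists_prime_pow_dvd_sq_sub hp h2 ha hx n
  have ne_zero {a : ℤ} (ha : ¬ (p : ℤ) ∣ a) : (a : ZMod p) ≠ 0 := by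
    rwa [Ne, ZMod.intCast_zmod_eq_zero_iff_dvd]
  rcases isSquare_of_four_or_isSquare_mul (ne_zero d7) (ne_zero d11) (ne_zero d19) (ne_zero d31)
    with h | h | h | h | h
  · exact ⟨7, by simp, lift d7 h⟩
  · exact ⟨11, by simp, lift d11 h⟩
  · exact ⟨19, by simp, lift d19 h⟩
  · exact ⟨31, by simp, lift d31 h⟩
  · refine ⟨45353, by simp, lift d ?_⟩
    rw [show (45353 : ℤ) = 7 * 11 * 19 * 31 by norm_num]
    exact_mod_cast h

theorem rat_sq_sub_natCast_ne_zero {n : ℕ} (hn : ¬ IsSquare n) (r : ℚ) : r ^ 2 - n ≠ 0 := by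
  intro h
  exact hn (Rat.isSquare_natCast_iff.mp ⟨r, by linear_combination -h⟩)


/-- `f(x) = (x² - 7)(x² - 11)(x² - 19)(x² - 31)(x² - 45353)` has a root modulo every
positive integer but no rational root. -/
theorem stmt_15 :
    (∀ m : ℕ, 0 < m → ∃ x : ℤ,
        (m : ℤ) ∣ (x ^ 2 - 7) * (x ^ 2 - 11) * (x ^ 2 - 19) * (x ^ 2 - 31) *
          (x ^ 2 - 45353)) ∧
      ¬ ∃ r : ℚ,
        (r ^ 2 - 7) * (r ^ 2 - 11) * (r ^ 2 - 19) * (r ^ 2 - 31) * (r ^ 2 - 45353) = 0 := by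
  constructor
  · let f : Polynomial ℤ := (.X ^ 2 - 7) * (.X ^ 2 - 11) * (.X ^ 2 - 19) * (.X ^ 2 - 31) *
      (.X ^ 2 - 45353)
    have hf (x : ℤ) : f.eval x = (x ^ 2 - 7) * (x ^ 2 - 11) * (x ^ 2 - 19) * (x ^ 2 - 31) *
        (x ^ 2 - 45353) := by simp [f]
    simp only [← hf]
    intro m
    induction m using Nat.recOnPosPrimePosCoprime with
    | prime_pow p n hp _ =>
      intro _
      simpa only [hf, Nat.cast_pow] using exists_prime_pow_dvd_sq_sub_product hp n
    | zero => simp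
    | one => simp
    | coprime a b ha hb hab iha ihb =>
      intro _
      rw [Nat.cast_mul]
      exact exists_mul_dvd_eval f (Nat.isCoprime_iff_coprime.mpr hab) (iha (by omega))
        (ihb (by omega))
  · rintro ⟨r, hr⟩
    have h7 := rat_sq_sub_natCast_ne_zero (n := 7) (by norm_num) r
    have h11 := rat_sq_sub_natCast_ne_zero (n := 11) (by norm_num) r
    have h19 := rat_sq_sub_natCast_ne_zero (n := 19) (by norm_num) r
    have h31 := rat_sq_sub_natCast_ne_zero (n := 31) (by norm_num) r
    have h := rat_sq_sub_natCast_ne_zero (n := 45353) (by norm_num) r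
    push_cast at h7 h11 h19 h31 h
    simp_all
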